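/- arXiv:1603.04910 — 5 statements merged into one kernel-verified Lean document; each statement's English description precedes it below -/
import Mathlib

section
/- Let H be a complex Hilbert space, J and K finite index sets, and let (A_j)_{j∈J}, (Γ_k)_{k∈K}, and (B_{jk})_{j∈J,k∈K} be bounded linear operators on H satisfying: ‖Σ_{j∈J} A_j* A_j‖ ≤ 1, ‖Σ_{k∈K} Γ_k Γ_k*‖ ≤ 1, and the family (B_{jk}) has matrix norm ≤ M. Then for all Hilbert–Schmidt operators T and R on H, the operator W = Σ_{j∈J} Σ_{k∈K} A_j ∘ T ∘ B_{jk} ∘ R ∘ Γ_k satisfies the trace-norm bound Σ_n |⟨u_n, W v_n⟩| ≤ M · ‖T‖_{S₂} · ‖R‖_{S₂} for all pairs of orthonormal sequences (u_n)_{n∈ℕ}, (v_n)_{n∈ℕ} in H. (This is the case p = q = 2, r = 1 of the Schatten–von Neumann theorem for triple operator integrals with integrand in the Haagerup tensor product.) -/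
open scoped InnerProductSpace ContinuousLinearMap

section

variable {H : Type*} [NormedAddCommGroup H] [InnerProductSpace ℂ H] {ι : Type*}

theorem HilbertBasis.hasSum_norm_inner_sq (b : HilbertBasis ι ℂ H) (x : H) :
    HasSum (fun i => ‖⟪b i, x⟫_ℂ‖ ^ 2) (‖x‖ ^ 2) := by
  have h := b.hasSum_inner_mul_inner x x
  rw [inner_self_eq_norm_sq_to_K] at h
  have h2 := Complex.hasSum_re h
  convert h2 using 1
  · ext i
    rw [← inner_conj_symm x (b i), RCLike.conj_mul]
    norm_cast
  · norm_cast

variable [CompleteSpace H]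

theorem HilbertBasis.hasSum_norm_adjoint_sq (b : HilbertBasis ι ℂ H) (S : H →L[ℂ] H)
    (hS : Summable fun i => ‖S (b i)‖ ^ 2) :
    HasSum (fun i => ‖ContinuousLinearMap.adjoint S (b i)‖ ^ 2) (∑' i, ‖S (b i)‖ ^ 2) := by
  let f : ι × ι → ℝ := fun p => ‖⟪b p.2, S (b p.1)⟫_ℂ‖ ^ 2
  have hrow (i : ι) : HasSum (fun j => f (i, j)) (‖S (b i)‖ ^ 2) :=
    b.hasSum_norm_inner_sq (S (b i))
  have hf : Summable f := by
    refine (summable_prod_of_nonneg fun p => by positivity).2 ⟨fun i => (hrow i).summable, ?_⟩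
    simpa only [(hrow _).tsum_eq] using hS
  have htot : HasSum f (∑' i, ‖S (b i)‖ ^ 2) := by
    have h := hf.hasSum
    rwa [hf.tsum_prod' fun i => (hrow i).summable, tsum_congr fun i => (hrow i).tsum_eq] at h
  refine ((Equiv.prodComm ι ι).hasSum_iff.2 htot).prod_fiberwise fun j => ?_
  convert b.hasSum_norm_inner_sq (ContinuousLinearMap.adjoint S (b j)) using 2 with i
  simp only [f, Function.comp_apply, Equiv.prodComm_apply, Prod.swap_prod_mk]
  rw [ContinuousLinearMap.adjoint_inner_right, norm_inner_symm]

theorem sum_norm_adjoint_sq_le {K : Type*} [Fintype K] (Γ : K → (H →L[ℂ] H))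
    (hΓ : ‖∑ k, (Γ k) ∘L (ContinuousLinearMap.adjoint (Γ k))‖ ≤ 1) (x : H) :
    ∑ k, ‖ContinuousLinearMap.adjoint (Γ k) x‖ ^ 2 ≤ ‖x‖ ^ 2 := by
  have h : ((∑ k, ‖ContinuousLinearMap.adjoint (Γ k) x‖ ^ 2 : ℝ) : ℂ) =
      ⟪x, (∑ k, (Γ k) ∘L (ContinuousLinearMap.adjoint (Γ k))) x⟫_ℂ := by
    simp only [sum_apply, inner_sum, ContinuousLinearMap.comp_apply,
      Complex.ofReal_sum]
    refine Finset.sum_congr rfl fun k _ => ?_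
    rw [← ContinuousLinearMap.adjoint_inner_left, inner_self_eq_norm_sq_to_K]
    norm_cast
  calc ∑ k, ‖ContinuousLinearMap.adjoint (Γ k) x‖ ^ 2
      ≤ ‖((∑ k, ‖ContinuousLinearMap.adjoint (Γ k) x‖ ^ 2 : ℝ) : ℂ)‖ := by
        rw [Complex.norm_real]
        exact le_abs_self _
    _ ≤ ‖x‖ * (1 * ‖x‖) := by
        rw [h]
        refine (norm_inner_le_norm _ _).trans ?_
        gcongr
        exact ContinuousLinearMap.le_of_opNorm_le _ hΓ x
    _ = ‖x‖ ^ 2 := by ring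

theorem sum_norm_adjoint_comp_sq_le (b : HilbertBasis ι ℂ H) {K : Type*} [Fintype K]
    (Γ : K → (H →L[ℂ] H))
    (hΓ : ‖∑ k, (Γ k) ∘L (ContinuousLinearMap.adjoint (Γ k))‖ ≤ 1) (S : H →L[ℂ] H)
    (hS : Summable fun i => ‖S (b i)‖ ^ 2) {κ : Type*} {v : κ → H} (hv : Orthonormal ℂ v)
    (N : Finset κ) :
    ∑ n ∈ N, ∑ k, ‖ContinuousLinearMap.adjoint S (Γ k (v n))‖ ^ 2 ≤ ∑' i, ‖S (b i)‖ ^ 2 := by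
  have h : HasSum
      (fun i => ∑ n ∈ N, ∑ k, ‖⟪b i, ContinuousLinearMap.adjoint S (Γ k (v n))⟫_ℂ‖ ^ 2)
      (∑ n ∈ N, ∑ k, ‖ContinuousLinearMap.adjoint S (Γ k (v n))‖ ^ 2) :=
    hasSum_sum fun n _ => hasSum_sum fun k _ => b.hasSum_norm_inner_sq _
  refine hasSum_le (fun i => ?_) h hS.hasSum
  rw [Finset.sum_comm]
  refine (Finset.sum_le_sum fun k _ => ?_).trans (sum_norm_adjoint_sq_le Γ hΓ (S (b i)))
  refine le_trans (le_of_eq (Finset.sum_congr rfl fun n _ => ?_))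
    (hv.sum_inner_products_le (ContinuousLinearMap.adjoint (Γ k) (S (b i))) (s := N))
  rw [ContinuousLinearMap.adjoint_inner_right, ContinuousLinearMap.adjoint_inner_right,
    norm_inner_symm]

end

/-- Case `p = q = 2`, `r = 1` of the Schatten–von Neumann theorem for triple operator
integrals with integrand in the Haagerup tensor product: under the row bound
`‖∑ j, (A j)* (A j)‖ ≤ 1`, the column bound `‖∑ k, Γ k (Γ k)*‖ ≤ 1` and the matrix
norm bound `M` on `(B j k)`, the operator `W = ∑ j, ∑ k, A j ∘ T ∘ B j k ∘ R ∘ Γ k`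
satisfies the trace-norm bound `∑ n, |⟨u n, W (v n)⟩| ≤ M * ‖T‖_{S₂} * ‖R‖_{S₂}`
for all orthonormal sequences `u, v`.  Hilbert–Schmidt norms are computed with respect
to a Hilbert basis `b`. -/
theorem triple_operator_integral_trace_class
    {H : Type*} [NormedAddCommGroup H] [InnerProductSpace ℂ H] [CompleteSpace H]
    {ι : Type*} (b : HilbertBasis ι ℂ H)
    {J K : Type*} [Fintype J] [Fintype K]
    (A : J → (H →L[ℂ] H)) (Γ : K → (H →L[ℂ] H)) (B : J → K → (H →L[ℂ] H))
    (M : ℝ) (hM : 0 ≤ M)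
    (hA : ‖∑ j : J, (ContinuousLinearMap.adjoint (A j)) ∘L (A j)‖ ≤ 1)
    (hΓ : ‖∑ k : K, (Γ k) ∘L (ContinuousLinearMap.adjoint (Γ k))‖ ≤ 1)
    (hB : ∀ x : K → H, ∑ j : J, ‖∑ k : K, (B j k) (x k)‖ ^ 2 ≤ M ^ 2 * ∑ k : K, ‖x k‖ ^ 2)
    (T R : H →L[ℂ] H)
    (hT : Summable fun i : ι => ‖T (b i)‖ ^ 2)
    (hR : Summable fun i : ι => ‖R (b i)‖ ^ 2)
    (u v : ℕ → H) (hu : Orthonormal ℂ u) (hv : Orthonormal ℂ v) (N : Finset ℕ) :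
    ∑ n ∈ N,
        ‖⟪u n, (∑ j : J, ∑ k : K, (A j) ∘L T ∘L (B j k) ∘L R ∘L (Γ k)) (v n)⟫_ℂ‖
      ≤ M * Real.sqrt (∑' i : ι, ‖T (b i)‖ ^ 2) * Real.sqrt (∑' i : ι, ‖R (b i)‖ ^ 2) := by
  have hTA : ∑ n ∈ N, ∑ j, ‖ContinuousLinearMap.adjoint T
      (ContinuousLinearMap.adjoint (A j) (u n))‖ ^ 2 ≤ ∑' i, ‖T (b i)‖ ^ 2 :=
    sum_norm_adjoint_comp_sq_le b (fun j => ContinuousLinearMap.adjoint (A j))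
      (by simpa only [ContinuousLinearMap.adjoint_adjoint] using hA) T hT hu N
  have hR' := b.hasSum_norm_adjoint_sq R hR
  have hRΓ : ∑ n ∈ N, ∑ k, ‖R (Γ k (v n))‖ ^ 2 ≤ ∑' i, ‖R (b i)‖ ^ 2 := by
    simpa only [ContinuousLinearMap.adjoint_adjoint, hR'.tsum_eq] using
      sum_norm_adjoint_comp_sq_le b Γ hΓ (ContinuousLinearMap.adjoint R) hR'.summable hv N
  have hBRΓ : ∑ n ∈ N, ∑ j, ‖∑ k, B j k (R (Γ k (v n)))‖ ^ 2 ≤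
      M ^ 2 * ∑' i, ‖R (b i)‖ ^ 2 := calc
    _ ≤ ∑ n ∈ N, M ^ 2 * ∑ k, ‖R (Γ k (v n))‖ ^ 2 :=
      Finset.sum_le_sum fun n _ => hB fun k => R (Γ k (v n))
    _ ≤ _ := by
      rw [← Finset.mul_sum]
      gcongr
  calc ∑ n ∈ N, ‖⟪u n, (∑ j, ∑ k, (A j) ∘L T ∘L (B j k) ∘L R ∘L (Γ k)) (v n)⟫_ℂ‖
      ≤ ∑ n ∈ N, ∑ j, ‖ContinuousLinearMap.adjoint T
          (ContinuousLinearMap.adjoint (A j) (u n))‖ * ‖∑ k, B j k (R (Γ k (v n)))‖ := by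
        refine Finset.sum_le_sum fun n _ => ?_
        rw [sum_apply, inner_sum]
        refine (norm_sum_le _ _).trans (Finset.sum_le_sum fun j _ => ?_)
        refine le_trans (le_of_eq ?_) (norm_inner_le_norm (𝕜 := ℂ) _ _)
        simp only [ContinuousLinearMap.adjoint_inner_left, sum_apply,
          ContinuousLinearMap.comp_apply, map_sum]
    _ ≤ √(∑ n ∈ N, ∑ j, ‖ContinuousLinearMap.adjoint T
          (ContinuousLinearMap.adjoint (A j) (u n))‖ ^ 2) *
        √(∑ n ∈ N, ∑ j, ‖∑ k, B j k (R (Γ k (v n)))‖ ^ 2) := by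
        simp only [← Finset.sum_product']
        exact Real.sum_mul_le_sqrt_mul_sqrt _ _ _
    _ ≤ √(∑' i, ‖T (b i)‖ ^ 2) * √(M ^ 2 * ∑' i, ‖R (b i)‖ ^ 2) := by gcongr
    _ = M * √(∑' i, ‖T (b i)‖ ^ 2) * √(∑' i, ‖R (b i)‖ ^ 2) := by
        rw [Real.sqrt_mul (sq_nonneg M), Real.sqrt_sq hM]
        ring
end

section
/- Let H be a complex Hilbert space, J and K finite index sets, and let (A_j)_{j∈J}, (Γ_k)_{k∈K}, and (B_{jk})_{j∈J,k∈K} be bounded linear operators on H satisfying: ‖Σ_{j∈J} A_j* A_j‖ ≤ 1, ‖Σ_{k∈K} Γ_k* Γ_k‖ ≤ 1, and the family (B_{jk}) has matrix norm ≤ M. Then for every Hilbert–Schmidt operator T and every bounded operator R on H, the operator W = Σ_{j∈J} Σ_{k∈K} A_j ∘ T ∘ B_{jk} ∘ R ∘ Γ_k is Hilbert–Schmidt with ‖W‖_{S₂} ≤ M · ‖T‖_{S₂} · ‖R‖. (This is the case p = 2, q = ∞ of the Schatten–von Neumann theorem for triple operator integrals with integrand in the Haagerup tensor product.) -/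
open scoped InnerProductSpace ContinuousLinearMap

open ContinuousLinearMap in
/-- If `‖∑ j, (A j)* (A j)‖ ≤ 1`, the column operator with entries `A j` is a contraction. -/
theorem sum_norm_sq_le_of_norm_sum_adjoint_comp_self_le_one
    {H : Type*} [NormedAddCommGroup H] [InnerProductSpace ℂ H] [CompleteSpace H]
    {J : Type*} [Fintype J] (A : J → (H →L[ℂ] H))
    (hA : ‖∑ j : J, adjoint (A j) ∘L A j‖ ≤ 1) (x : H) :
    ∑ j, ‖A j x‖ ^ 2 ≤ ‖x‖ ^ 2 := by
  set S := ∑ j : J, adjoint (A j) ∘L A j with hS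
  calc ∑ j, ‖A j x‖ ^ 2 = RCLike.re (⟪S x, x⟫_ℂ) := by
        simp only [hS, sum_apply, sum_inner, map_sum, apply_norm_sq_eq_inner_adjoint_left]
    _ ≤ ‖S x‖ * ‖x‖ := re_inner_le_norm _ _
    _ ≤ (1 * ‖x‖) * ‖x‖ := by
        gcongr
        exact S.le_of_opNorm_le hA x
    _ = ‖x‖ ^ 2 := by ring

open ContinuousLinearMap in
/-- The row operator with entries `(D j)*` obeys the norm bound of the column with entries `D j`. -/
theorem norm_sq_sum_adjoint_apply_le
    {H : Type*} [NormedAddCommGroup H] [InnerProductSpace ℂ H] [CompleteSpace H]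
    {J : Type*} [Fintype J] (D : J → (H →L[ℂ] H)) {C : ℝ}
    (hD : ∀ x, ∑ j, ‖D j x‖ ^ 2 ≤ C ^ 2 * ‖x‖ ^ 2) (y : J → H) :
    ‖∑ j, adjoint (D j) (y j)‖ ^ 2 ≤ C ^ 2 * ∑ j, ‖y j‖ ^ 2 := by
  set v := ∑ j, adjoint (D j) (y j) with hv
  have h1 : ‖v‖ ^ 2 ≤ ∑ j, ‖y j‖ * ‖D j v‖ := by
    calc ‖v‖ ^ 2 = RCLike.re (⟪v, v⟫_ℂ) := (inner_self_eq_norm_sq v).symm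
      _ = ∑ j, RCLike.re (⟪y j, D j v⟫_ℂ) := by
        nth_rewrite 1 [hv]
        simp only [sum_inner, map_sum, adjoint_inner_left]
      _ ≤ ∑ j, ‖y j‖ * ‖D j v‖ := Finset.sum_le_sum fun j _ => re_inner_le_norm _ _
  have h2 : (‖v‖ ^ 2) ^ 2 ≤ (C ^ 2 * ∑ j, ‖y j‖ ^ 2) * ‖v‖ ^ 2 := by
    calc (‖v‖ ^ 2) ^ 2 ≤ (∑ j, ‖y j‖ * ‖D j v‖) ^ 2 := by gcongr
      _ ≤ (∑ j, ‖y j‖ ^ 2) * ∑ j, ‖D j v‖ ^ 2 := Finset.sum_mul_sq_le_sq_mul_sq _ _ _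
      _ ≤ (∑ j, ‖y j‖ ^ 2) * (C ^ 2 * ‖v‖ ^ 2) := by
        gcongr
        exact hD v
      _ = _ := by ring
  rcases (sq_nonneg ‖v‖).eq_or_lt with h0 | h0
  · rw [← h0]
    positivity
  · exact le_of_mul_le_mul_right (by rwa [← sq]) h0

open ContinuousLinearMap in
/-- An operator and its adjoint have the same (possibly infinite) Hilbert–Schmidt norm. -/
theorem tsum_norm_sq_adjoint_apply
    {H : Type*} [NormedAddCommGroup H] [InnerProductSpace ℂ H] [CompleteSpace H]
    {ι : Type*} (b : HilbertBasis ι ℂ H) (X : H →L[ℂ] H) :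
    ∑' i, ENNReal.ofReal (‖adjoint X (b i)‖ ^ 2) = ∑' i, ENNReal.ofReal (‖X (b i)‖ ^ 2) := by
  have parseval (x : H) :
      ENNReal.ofReal (‖x‖ ^ 2) = ∑' i, ENNReal.ofReal (‖⟪b i, x⟫_ℂ‖ ^ 2) := by
    have h : HasSum (fun i => ‖⟪b i, x⟫_ℂ‖ ^ 2) (‖x‖ ^ 2) := by
      have h := (b.hasSum_inner_mul_inner x x).mapL (RCLike.reCLM (K := ℂ))
      simpa only [RCLike.reCLM_apply, inner_mul_symm_re_eq_norm, norm_mul, norm_inner_symm x,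
        ← sq, inner_self_eq_norm_sq] using h
    rw [← h.tsum_eq, ENNReal.ofReal_tsum_of_nonneg (fun _ => by positivity) h.summable]
  simp_rw [parseval]
  rw [ENNReal.tsum_comm]
  simp_rw [adjoint_inner_right, ← norm_inner_symm (b _) (X _)]

open ContinuousLinearMap in
/-- The Hilbert–Schmidt norm of a row times a bounded column. -/
theorem tsum_norm_sq_sum_comp_le
    {H : Type*} [NormedAddCommGroup H] [InnerProductSpace ℂ H] [CompleteSpace H]
    {ι : Type*} (b : HilbertBasis ι ℂ H) {J : Type*} [Fintype J]
    (X D : J → (H →L[ℂ] H)) {C : ℝ}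
    (hD : ∀ x, ∑ j, ‖D j x‖ ^ 2 ≤ C ^ 2 * ‖x‖ ^ 2) :
    ∑' i, ENNReal.ofReal (‖(∑ j, X j ∘L D j) (b i)‖ ^ 2) ≤
      ENNReal.ofReal (C ^ 2) * ∑ j, ∑' i, ENNReal.ofReal (‖X j (b i)‖ ^ 2) := by
  simp_rw [← tsum_norm_sq_adjoint_apply b (X _)]
  rw [← tsum_norm_sq_adjoint_apply b]
  rw [← Summable.tsum_finsetSum fun _ _ => ENNReal.summable, ← ENNReal.tsum_mul_left]
  gcongr with i
  rw [← ENNReal.ofReal_sum_of_nonneg fun _ _ => by positivity,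
    ← ENNReal.ofReal_mul (by positivity)]
  refine ENNReal.ofReal_le_ofReal ?_
  simpa [map_sum, adjoint_comp, sum_apply] using
    norm_sq_sum_adjoint_apply_le D hD fun j => adjoint (X j) (b i)

/-- Case `p = 2`, `q = ∞` of the Schatten–von Neumann theorem for triple operator
integrals with integrand in the Haagerup tensor product: if `‖∑ j, (A j)* (A j)‖ ≤ 1`,
`‖∑ k, (Γ k)* (Γ k)‖ ≤ 1`, the family `(B j k)` has matrix norm at most `M`,
`T` is Hilbert–Schmidt and `R` is bounded, then
`W = ∑ j, ∑ k, A j ∘ T ∘ B j k ∘ R ∘ Γ k` is Hilbert–Schmidt and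
`‖W‖_{S₂} ≤ M * ‖T‖_{S₂} * ‖R‖`.  Hilbert–Schmidt norms are computed with respect
to a Hilbert basis `b`. -/
theorem triple_operator_integral_S2_Sinfty
    {H : Type*} [NormedAddCommGroup H] [InnerProductSpace ℂ H] [CompleteSpace H]
    {ι : Type*} (b : HilbertBasis ι ℂ H)
    {J K : Type*} [Fintype J] [Fintype K]
    (A : J → (H →L[ℂ] H)) (Γ : K → (H →L[ℂ] H)) (B : J → K → (H →L[ℂ] H))
    (M : ℝ) (hM : 0 ≤ M)
    (hA : ‖∑ j : J, (ContinuousLinearMap.adjoint (A j)) ∘L (A j)‖ ≤ 1)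
    (hΓ : ‖∑ k : K, (ContinuousLinearMap.adjoint (Γ k)) ∘L (Γ k)‖ ≤ 1)
    (hB : ∀ x : K → H, ∑ j : J, ‖∑ k : K, (B j k) (x k)‖ ^ 2 ≤ M ^ 2 * ∑ k : K, ‖x k‖ ^ 2)
    (T R : H →L[ℂ] H)
    (hT : Summable fun i : ι => ‖T (b i)‖ ^ 2) :
    Summable (fun i : ι =>
        ‖(∑ j : J, ∑ k : K, (A j) ∘L T ∘L (B j k) ∘L R ∘L (Γ k)) (b i)‖ ^ 2) ∧
      Real.sqrt (∑' i : ι,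
          ‖(∑ j : J, ∑ k : K, (A j) ∘L T ∘L (B j k) ∘L R ∘L (Γ k)) (b i)‖ ^ 2)
        ≤ M * Real.sqrt (∑' i : ι, ‖T (b i)‖ ^ 2) * ‖R‖ := by
  set W := ∑ j : J, ∑ k : K, (A j) ∘L T ∘L (B j k) ∘L R ∘L (Γ k) with hW
  let D : J → H →L[ℂ] H := fun j => ∑ k : K, (B j k) ∘L R ∘L (Γ k)
  have hD : ∀ x, ∑ j, ‖D j x‖ ^ 2 ≤ (M * ‖R‖) ^ 2 * ‖x‖ ^ 2 := fun x => by
    calc ∑ j, ‖D j x‖ ^ 2 = ∑ j, ‖∑ k, B j k (R (Γ k x))‖ ^ 2 := by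
          simp [D]
      _ ≤ M ^ 2 * ∑ k, ‖R (Γ k x)‖ ^ 2 := hB fun k => R (Γ k x)
      _ ≤ M ^ 2 * ∑ k, (‖R‖ * ‖Γ k x‖) ^ 2 := by
          gcongr
          exact R.le_opNorm _
      _ = (M * ‖R‖) ^ 2 * ∑ k, ‖Γ k x‖ ^ 2 := by
          simp only [mul_pow, ← Finset.mul_sum, mul_assoc]
      _ ≤ (M * ‖R‖) ^ 2 * ‖x‖ ^ 2 := by
          gcongr
          exact sum_norm_sq_le_of_norm_sum_adjoint_comp_self_le_one Γ hΓ x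
  have hWD : W = ∑ j, (A j ∘L T) ∘L D j := by
    ext x
    simp [hW, D, map_sum]
  have key : ∑' i, ENNReal.ofReal (‖W (b i)‖ ^ 2) ≤
      ENNReal.ofReal ((M * ‖R‖) ^ 2 * ∑' i, ‖T (b i)‖ ^ 2) := by
    rw [hWD, ENNReal.ofReal_mul (by positivity),
      ENNReal.ofReal_tsum_of_nonneg (fun _ => by positivity) hT]
    refine (tsum_norm_sq_sum_comp_le b (fun j => A j ∘L T) D hD).trans ?_
    rw [← Summable.tsum_finsetSum fun _ _ => ENNReal.summable]
    gcongr with i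
    rw [← ENNReal.ofReal_sum_of_nonneg fun _ _ => by positivity]
    exact ENNReal.ofReal_le_ofReal
      (sum_norm_sq_le_of_norm_sum_adjoint_comp_self_le_one A hA (T (b i)))
  have hsum : Summable fun i => ‖W (b i)‖ ^ 2 := by
    have h := ENNReal.summable_toReal (ne_top_of_le_ne_top ENNReal.ofReal_ne_top key)
    simpa only [ENNReal.toReal_ofReal (sq_nonneg _)] using h
  refine ⟨hsum, ?_⟩
  have hT0 : 0 ≤ ∑' i, ‖T (b i)‖ ^ 2 := tsum_nonneg fun _ => by positivity
  rw [← ENNReal.ofReal_tsum_of_nonneg (fun _ => by positivity) hsum,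
    ENNReal.ofReal_le_ofReal_iff (by positivity)] at key
  refine (Real.sqrt_le_sqrt key).trans_eq ?_
  rw [Real.sqrt_mul (by positivity), Real.sqrt_sq (by positivity)]
  ring
end

section
/- Let H be a complex Hilbert space, J and K finite index sets, and let (A_j)_{j∈J}, (Γ_k)_{k∈K}, and (B_{jk})_{j∈J,k∈K} be bounded linear operators on H satisfying: ‖Σ_{j∈J} A_j A_j*‖ ≤ 1, ‖Σ_{k∈K} Γ_k* Γ_k‖ ≤ 1, and the family (B_{jk}) has matrix norm ≤ M. Then for all bounded operators T and R on H, the operator W = Σ_{j∈J} Σ_{k∈K} A_j ∘ T ∘ B_{jk} ∘ R ∘ Γ_k satisfies the operator-norm bound ‖W‖ ≤ M · ‖T‖ · ‖R‖. (This is the boundedness estimate for triple operator integrals with integrand in the Haagerup tensor product of L∞ spaces.) -/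
open scoped InnerProductSpace ContinuousLinearMap

section ColumnRow

variable {H : Type*} [NormedAddCommGroup H] [InnerProductSpace ℂ H]
  {ι : Type*} [Fintype ι]

/-- A column of operators with `‖∑ i, (C i)* (C i)‖ ≤ 1` is a contraction into the
`ℓ²`-sum. -/
theorem sum_norm_sq_apply_le_of_norm_sum_adjoint_comp_le_one [CompleteSpace H]
    (C : ι → (H →L[ℂ] H))
    (hC : ‖∑ i, (ContinuousLinearMap.adjoint (C i)) ∘L (C i)‖ ≤ 1) (x : H) :
    ∑ i, ‖C i x‖ ^ 2 ≤ ‖x‖ ^ 2 := by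
  set S := ∑ i, (ContinuousLinearMap.adjoint (C i)) ∘L (C i) with hS
  calc ∑ i, ‖C i x‖ ^ 2 = RCLike.re ⟪S x, x⟫_ℂ := by
        simp only [hS, sum_apply, sum_inner, map_sum,
          ContinuousLinearMap.comp_apply, ContinuousLinearMap.adjoint_inner_left,
          inner_self_eq_norm_sq]
    _ ≤ ‖S x‖ * ‖x‖ := re_inner_le_norm _ _
    _ ≤ (1 * ‖x‖) * ‖x‖ := by
        gcongr
        exact S.le_of_opNorm_le hC x
    _ = ‖x‖ ^ 2 := by ring

/-- A row of operators with `‖∑ i, (A i) (A i)*‖ ≤ 1` is a contraction from the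
`ℓ²`-sum. -/
theorem norm_sq_sum_apply_le_of_norm_sum_comp_adjoint_le_one [CompleteSpace H]
    (A : ι → (H →L[ℂ] H))
    (hA : ‖∑ i, (A i) ∘L (ContinuousLinearMap.adjoint (A i))‖ ≤ 1) (y : ι → H) :
    ‖∑ i, A i (y i)‖ ^ 2 ≤ ∑ i, ‖y i‖ ^ 2 := by
  set s := ∑ i, A i (y i) with hs
  have hcol : ∑ i, ‖ContinuousLinearMap.adjoint (A i) s‖ ^ 2 ≤ ‖s‖ ^ 2 :=
    sum_norm_sq_apply_le_of_norm_sum_adjoint_comp_le_one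
      (fun i => ContinuousLinearMap.adjoint (A i)) (by simpa using hA) s
  have hexp : ‖s‖ ^ 2 = ∑ i, RCLike.re ⟪ContinuousLinearMap.adjoint (A i) s, y i⟫_ℂ := by
    simp only [ContinuousLinearMap.adjoint_inner_left]
    rw [← map_sum, ← inner_sum, ← hs, inner_self_eq_norm_sq]
  have hyoung : ‖s‖ ^ 2 ≤
      ∑ i, (‖ContinuousLinearMap.adjoint (A i) s‖ ^ 2 + ‖y i‖ ^ 2) / 2 := by
    rw [hexp]
    refine Finset.sum_le_sum fun i _ => ?_
    have h := re_inner_le_norm (𝕜 := ℂ) (ContinuousLinearMap.adjoint (A i) s) (y i)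
    linarith [two_mul_le_add_sq ‖ContinuousLinearMap.adjoint (A i) s‖ ‖y i‖]
  rw [← Finset.sum_div, Finset.sum_add_distrib] at hyoung
  linarith

/-- Applying one operator entrywise multiplies the `ℓ²`-norm by at most its norm. -/
theorem sum_norm_sq_apply_le (T : H →L[ℂ] H) (y : ι → H) :
    ∑ i, ‖T (y i)‖ ^ 2 ≤ ‖T‖ ^ 2 * ∑ i, ‖y i‖ ^ 2 := by
  rw [Finset.mul_sum]
  refine Finset.sum_le_sum fun i _ => ?_
  rw [← mul_pow]
  gcongr
  exact T.le_opNorm _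

end ColumnRow

/-- Boundedness estimate for triple operator integrals with integrand in the Haagerup
tensor product: if `‖∑ j, A j (A j)*‖ ≤ 1`, `‖∑ k, (Γ k)* (Γ k)‖ ≤ 1` and the family
`(B j k)` has matrix norm at most `M`, then for all bounded operators `T, R`,
`‖∑ j, ∑ k, A j ∘ T ∘ B j k ∘ R ∘ Γ k‖ ≤ M * ‖T‖ * ‖R‖`. -/
theorem triple_operator_integral_bounded
    {H : Type*} [NormedAddCommGroup H] [InnerProductSpace ℂ H] [CompleteSpace H]
    {J K : Type*} [Fintype J] [Fintype K]
    (A : J → (H →L[ℂ] H)) (Γ : K → (H →L[ℂ] H)) (B : J → K → (H →L[ℂ] H))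
    (M : ℝ) (hM : 0 ≤ M)
    (hA : ‖∑ j : J, (A j) ∘L (ContinuousLinearMap.adjoint (A j))‖ ≤ 1)
    (hΓ : ‖∑ k : K, (ContinuousLinearMap.adjoint (Γ k)) ∘L (Γ k)‖ ≤ 1)
    (hB : ∀ x : K → H, ∑ j : J, ‖∑ k : K, (B j k) (x k)‖ ^ 2 ≤ M ^ 2 * ∑ k : K, ‖x k‖ ^ 2)
    (T R : H →L[ℂ] H) :
    ‖∑ j : J, ∑ k : K, (A j) ∘L T ∘L (B j k) ∘L R ∘L (Γ k)‖ ≤ M * ‖T‖ * ‖R‖ := by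
  refine ContinuousLinearMap.opNorm_le_bound _ (by positivity) fun x => ?_
  refine (sq_le_sq₀ (norm_nonneg _) (by positivity)).mp ?_
  have hW : (∑ j : J, ∑ k : K, (A j) ∘L T ∘L (B j k) ∘L R ∘L (Γ k)) x
      = ∑ j, A j (T (∑ k, B j k (R (Γ k x)))) := by
    simp
  rw [hW]
  calc ‖∑ j, A j (T (∑ k, B j k (R (Γ k x))))‖ ^ 2
      ≤ ∑ j, ‖T (∑ k, B j k (R (Γ k x)))‖ ^ 2 :=
        norm_sq_sum_apply_le_of_norm_sum_comp_adjoint_le_one A hA _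
    _ ≤ ‖T‖ ^ 2 * ∑ j, ‖∑ k, B j k (R (Γ k x))‖ ^ 2 := sum_norm_sq_apply_le T _
    _ ≤ ‖T‖ ^ 2 * (M ^ 2 * ∑ k, ‖R (Γ k x)‖ ^ 2) := by
        gcongr
        exact hB _
    _ ≤ ‖T‖ ^ 2 * (M ^ 2 * (‖R‖ ^ 2 * ∑ k, ‖Γ k x‖ ^ 2)) := by
        gcongr
        exact sum_norm_sq_apply_le R _
    _ ≤ ‖T‖ ^ 2 * (M ^ 2 * (‖R‖ ^ 2 * ‖x‖ ^ 2)) := by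
        gcongr
        exact sum_norm_sq_apply_le_of_norm_sum_adjoint_comp_le_one Γ hΓ x
    _ = (M * ‖T‖ * ‖R‖ * ‖x‖) ^ 2 := by ring
end

section
/- Let H be a complex Hilbert space, let J, K, L be finite index sets, and let (A_j)_{j∈J}, (Δ_l)_{l∈L}, (B_{jk})_{j∈J,k∈K}, (Γ_{kl})_{k∈K,l∈L} be bounded linear operators on H satisfying: ‖Σ_{j∈J} A_j* A_j‖ ≤ 1, ‖Σ_{l∈L} Δ_l Δ_l*‖ ≤ 1, the family (B_{jk}) has matrix norm ≤ M₁, and the family (Γ_{kl}) has matrix norm ≤ M₂. Then for all Hilbert–Schmidt operators T₁, T₃ on H and every bounded operator T₂ on H, the operator W = Σ_{j∈J} Σ_{k∈K} Σ_{l∈L} A_j ∘ T₁ ∘ B_{jk} ∘ T₂ ∘ Γ_{kl} ∘ T₃ ∘ Δ_l satisfies the trace-norm bound Σ_n |⟨u_n, W v_n⟩| ≤ M₁ · M₂ · ‖T₁‖_{S₂} · ‖T₂‖ · ‖T₃‖_{S₂} for all pairs of orthonormal sequences (u_n)_{n∈ℕ}, (v_n)_{n∈ℕ} in H. (This is the case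 m = 4, p = q = 2, r = 1 of the Schatten–von Neumann theorem for multiple operator integrals with integrand in the Haagerup tensor product.) -/
open scoped InnerProductSpace ContinuousLinearMap

theorem HilbertBasis.hasSum_norm_sq_inner {𝕜 E ι : Type*} [RCLike 𝕜] [NormedAddCommGroup E]
    [InnerProductSpace 𝕜 E] (b : HilbertBasis ι 𝕜 E) (x : E) :
    HasSum (fun i => ‖⟪b i, x⟫_𝕜‖ ^ 2) (‖x‖ ^ 2) := by
  have h := RCLike.hasSum_re 𝕜 (b.hasSum_inner_mul_inner x x)
  rw [inner_self_eq_norm_sq] at h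
  convert h using 2 with i
  rw [inner_mul_symm_re_eq_norm, norm_mul, norm_inner_symm x, sq]

/-- A column `C` with `‖∑ l, (C l)* (C l)‖ ≤ 1` is contractive. -/
theorem sum_norm_sq_apply_le_of_norm_sum_adjoint_comp_le_one_s8 {𝕜 E L : Type*} [RCLike 𝕜]
    [NormedAddCommGroup E] [InnerProductSpace 𝕜 E] [CompleteSpace E] [Fintype L]
    (C : L → E →L[𝕜] E)
    (hC : ‖∑ l, (ContinuousLinearMap.adjoint (C l)) ∘L (C l)‖ ≤ 1) (x : E) :
    ∑ l, ‖C l x‖ ^ 2 ≤ ‖x‖ ^ 2 := by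
  have h : ∑ l, ‖C l x‖ ^ 2 =
      RCLike.re ⟪(∑ l, (ContinuousLinearMap.adjoint (C l)) ∘L (C l)) x, x⟫_𝕜 := by
    simp [sum_inner, ContinuousLinearMap.adjoint_inner_left]
  rw [h]
  calc _ ≤ ‖(∑ l, (ContinuousLinearMap.adjoint (C l)) ∘L (C l)) x‖ * ‖x‖ :=
        re_inner_le_norm _ _
    _ ≤ 1 * ‖x‖ * ‖x‖ := by gcongr; exact ContinuousLinearMap.le_of_opNorm_le _ hC x
    _ = ‖x‖ ^ 2 := by ring

/-- The Hilbert–Schmidt norm of the column `(S* (C l)*)` is at most that of `S` when `C` is a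
contractive column, tested against a finite part of an orthonormal family. -/
theorem sum_norm_sq_adjoint_comp_adjoint_le {𝕜 E ι κ L : Type*} [RCLike 𝕜]
    [NormedAddCommGroup E] [InnerProductSpace 𝕜 E] [CompleteSpace E] [Fintype L]
    (b : HilbertBasis ι 𝕜 E) (C : L → E →L[𝕜] E)
    (hC : ‖∑ l, (ContinuousLinearMap.adjoint (C l)) ∘L (C l)‖ ≤ 1)
    (S : E →L[𝕜] E) (hS : Summable fun i => ‖S (b i)‖ ^ 2)
    {v : κ → E} (hv : Orthonormal 𝕜 v) (N : Finset κ) :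
    ∑ n ∈ N, ∑ l, ‖ContinuousLinearMap.adjoint S (ContinuousLinearMap.adjoint (C l) (v n))‖ ^ 2
      ≤ ∑' i, ‖S (b i)‖ ^ 2 := by
  have h := hasSum_sum (s := N) fun n _ => hasSum_sum (s := Finset.univ) fun l (_ : l ∈ _) =>
    b.hasSum_norm_sq_inner
      (ContinuousLinearMap.adjoint S (ContinuousLinearMap.adjoint (C l) (v n)))
  refine hasSum_le (fun i => ?_) h hS.hasSum
  rw [Finset.sum_comm]
  refine le_trans (Finset.sum_le_sum fun l _ => ?_)
    (sum_norm_sq_apply_le_of_norm_sum_adjoint_comp_le_one_s8 C hC (S (b i)))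
  simp only [ContinuousLinearMap.adjoint_inner_right]
  simp only [norm_inner_symm (C l (S (b i)))]
  exact hv.sum_inner_products_le _

theorem sum_norm_sq_adjoint_le {𝕜 E ι κ : Type*} [RCLike 𝕜]
    [NormedAddCommGroup E] [InnerProductSpace 𝕜 E] [CompleteSpace E]
    (b : HilbertBasis ι 𝕜 E) (S : E →L[𝕜] E) (hS : Summable fun i => ‖S (b i)‖ ^ 2)
    {v : κ → E} (hv : Orthonormal 𝕜 v) (N : Finset κ) :
    ∑ n ∈ N, ‖ContinuousLinearMap.adjoint S (v n)‖ ^ 2 ≤ ∑' i, ‖S (b i)‖ ^ 2 := by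
  have hC : ‖∑ _ : Unit, (ContinuousLinearMap.adjoint (.id 𝕜 E)) ∘L (.id 𝕜 E)‖ ≤ 1 := by
    simpa using ContinuousLinearMap.norm_id_le
  simpa only [ContinuousLinearMap.adjoint_id, ContinuousLinearMap.id_apply, Finset.univ_unique,
    Finset.sum_singleton] using
    sum_norm_sq_adjoint_comp_adjoint_le b (fun _ : Unit => .id 𝕜 E) hC S hS hv N

theorem norm_sum_inner_le_sqrt_mul_sqrt {𝕜 E J : Type*} [RCLike 𝕜] [NormedAddCommGroup E]
    [InnerProductSpace 𝕜 E] (s : Finset J) (x y : J → E) :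
    ‖∑ j ∈ s, ⟪x j, y j⟫_𝕜‖ ≤ √(∑ j ∈ s, ‖x j‖ ^ 2) * √(∑ j ∈ s, ‖y j‖ ^ 2) :=
  (norm_sum_le_of_le _ fun _ _ => norm_inner_le_norm _ _).trans
    (Real.sum_mul_le_sqrt_mul_sqrt _ _ _)

/-- Case `m = 4`, `p = q = 2`, `r = 1` of the Schatten–von Neumann theorem for multiple
operator integrals with integrand in the Haagerup tensor product: under the row bound
`‖∑ j, (A j)* (A j)‖ ≤ 1`, the column bound `‖∑ l, Δ l (Δ l)*‖ ≤ 1` and matrix norm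
bounds `M₁, M₂` on `(B j k)` and `(Γ k l)`, for Hilbert–Schmidt `T₁, T₃` and bounded
`T₂`, the operator `W = ∑ j k l, A j ∘ T₁ ∘ B j k ∘ T₂ ∘ Γ k l ∘ T₃ ∘ Δ l` satisfies
the trace-norm bound `∑ n, |⟨u n, W (v n)⟩| ≤ M₁ * M₂ * ‖T₁‖_{S₂} * ‖T₂‖ * ‖T₃‖_{S₂}`
for all orthonormal sequences `u, v`.  Hilbert–Schmidt norms are computed with respect
to a Hilbert basis `b`. -/
theorem quadruple_operator_integral_trace_class
    {H : Type*} [NormedAddCommGroup H] [InnerProductSpace ℂ H] [CompleteSpace H]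
    {ι : Type*} (b : HilbertBasis ι ℂ H)
    {J K L : Type*} [Fintype J] [Fintype K] [Fintype L]
    (A : J → (H →L[ℂ] H)) (Δ : L → (H →L[ℂ] H))
    (B : J → K → (H →L[ℂ] H)) (Γ : K → L → (H →L[ℂ] H))
    (M₁ M₂ : ℝ) (hM₁ : 0 ≤ M₁) (hM₂ : 0 ≤ M₂)
    (hA : ‖∑ j : J, (ContinuousLinearMap.adjoint (A j)) ∘L (A j)‖ ≤ 1)
    (hΔ : ‖∑ l : L, (Δ l) ∘L (ContinuousLinearMap.adjoint (Δ l))‖ ≤ 1)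
    (hB : ∀ x : K → H, ∑ j : J, ‖∑ k : K, (B j k) (x k)‖ ^ 2 ≤ M₁ ^ 2 * ∑ k : K, ‖x k‖ ^ 2)
    (hΓ : ∀ x : L → H, ∑ k : K, ‖∑ l : L, (Γ k l) (x l)‖ ^ 2 ≤ M₂ ^ 2 * ∑ l : L, ‖x l‖ ^ 2)
    (T₁ T₂ T₃ : H →L[ℂ] H)
    (hT₁ : Summable fun i : ι => ‖T₁ (b i)‖ ^ 2)
    (hT₃ : Summable fun i : ι => ‖T₃ (b i)‖ ^ 2)
    (u v : ℕ → H) (hu : Orthonormal ℂ u) (hv : Orthonormal ℂ v) (N : Finset ℕ) :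
    ∑ n ∈ N,
        ‖⟪u n, (∑ j : J, ∑ k : K, ∑ l : L,
            (A j) ∘L T₁ ∘L (B j k) ∘L T₂ ∘L (Γ k l) ∘L T₃ ∘L (Δ l)) (v n)⟫_ℂ‖
      ≤ M₁ * M₂ * Real.sqrt (∑' i : ι, ‖T₁ (b i)‖ ^ 2) * ‖T₂‖ *
          Real.sqrt (∑' i : ι, ‖T₃ (b i)‖ ^ 2) := by
  have hS₃ := sum_norm_sq_adjoint_le b T₃ hT₃ b.orthonormal
  have hsum₃ : Summable fun i => ‖ContinuousLinearMap.adjoint T₃ (b i)‖ ^ 2 :=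
    summable_of_sum_le (fun _ => by positivity) hS₃
  have hX := sum_norm_sq_adjoint_comp_adjoint_le b A hA T₁ hT₁ hu N
  have hY : ∑ n ∈ N, ∑ l, ‖T₃ (Δ l (v n))‖ ^ 2 ≤ ∑' i, ‖T₃ (b i)‖ ^ 2 := by
    have h := sum_norm_sq_adjoint_comp_adjoint_le b
      (fun l => ContinuousLinearMap.adjoint (Δ l)) (by simpa using hΔ)
      (ContinuousLinearMap.adjoint T₃) hsum₃ hv N
    simp only [ContinuousLinearMap.adjoint_adjoint] at h
    exact h.trans (hsum₃.tsum_le_of_sum_le hS₃)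
  have hmid (x : H) :
      √(∑ j, ‖∑ k, B j k (T₂ (∑ l, Γ k l (T₃ (Δ l x))))‖ ^ 2)
        ≤ M₁ * M₂ * ‖T₂‖ * √(∑ l, ‖T₃ (Δ l x)‖ ^ 2) := by
    refine Real.sqrt_le_iff.2 ⟨by positivity, ?_⟩
    rw [mul_pow, Real.sq_sqrt (by positivity)]
    calc _ ≤ M₁ ^ 2 * ∑ k, ‖T₂ (∑ l, Γ k l (T₃ (Δ l x)))‖ ^ 2 :=
          hB fun k => T₂ (∑ l, Γ k l (T₃ (Δ l x)))
      _ ≤ M₁ ^ 2 * ∑ k, (‖T₂‖ * ‖∑ l, Γ k l (T₃ (Δ l x))‖) ^ 2 := by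
          gcongr; exact T₂.le_opNorm _
      _ = M₁ ^ 2 * ‖T₂‖ ^ 2 * ∑ k, ‖∑ l, Γ k l (T₃ (Δ l x))‖ ^ 2 := by
          simp only [mul_pow, ← Finset.mul_sum, mul_assoc]
      _ ≤ M₁ ^ 2 * ‖T₂‖ ^ 2 * (M₂ ^ 2 * ∑ l, ‖T₃ (Δ l x)‖ ^ 2) := by
          gcongr; exact hΓ fun l => T₃ (Δ l x)
      _ = _ := by ring
  have hterm (n : ℕ) :
      ‖⟪u n, (∑ j : J, ∑ k : K, ∑ l : L,
          (A j) ∘L T₁ ∘L (B j k) ∘L T₂ ∘L (Γ k l) ∘L T₃ ∘L (Δ l)) (v n)⟫_ℂ‖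
        ≤ √(∑ j, ‖ContinuousLinearMap.adjoint T₁ (ContinuousLinearMap.adjoint (A j) (u n))‖ ^ 2)
          * (M₁ * M₂ * ‖T₂‖ * √(∑ l, ‖T₃ (Δ l (v n))‖ ^ 2)) := by
    have h : ⟪u n, (∑ j : J, ∑ k : K, ∑ l : L,
          (A j) ∘L T₁ ∘L (B j k) ∘L T₂ ∘L (Γ k l) ∘L T₃ ∘L (Δ l)) (v n)⟫_ℂ
        = ∑ j, ⟪ContinuousLinearMap.adjoint T₁ (ContinuousLinearMap.adjoint (A j) (u n)),
            ∑ k, B j k (T₂ (∑ l, Γ k l (T₃ (Δ l (v n)))))⟫_ℂ := by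
      simp only [ContinuousLinearMap.adjoint_inner_left, sum_apply,
        ContinuousLinearMap.comp_apply, inner_sum, map_sum]
    rw [h]
    exact (norm_sum_inner_le_sqrt_mul_sqrt _ _ _).trans
      (mul_le_mul_of_nonneg_left (hmid _) (Real.sqrt_nonneg _))
  calc _ ≤ ∑ n ∈ N,
        √(∑ j, ‖ContinuousLinearMap.adjoint T₁ (ContinuousLinearMap.adjoint (A j) (u n))‖ ^ 2)
          * (M₁ * M₂ * ‖T₂‖ * √(∑ l, ‖T₃ (Δ l (v n))‖ ^ 2)) :=
        Finset.sum_le_sum fun n _ => hterm n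
    _ = M₁ * M₂ * ‖T₂‖ * ∑ n ∈ N,
        √(∑ j, ‖ContinuousLinearMap.adjoint T₁ (ContinuousLinearMap.adjoint (A j) (u n))‖ ^ 2)
          * √(∑ l, ‖T₃ (Δ l (v n))‖ ^ 2) := by
        rw [Finset.mul_sum]
        exact Finset.sum_congr rfl fun n _ => by ring
    _ ≤ M₁ * M₂ * ‖T₂‖ * (√(∑' i, ‖T₁ (b i)‖ ^ 2) * √(∑' i, ‖T₃ (b i)‖ ^ 2)) := by
        gcongr
        refine (Real.sum_sqrt_mul_sqrt_le _ (fun _ => by positivity)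
          (fun _ => by positivity)).trans ?_
        gcongr
    _ = _ := by ring
end

section
/- Let H be a complex Hilbert space, let J, K, L be finite index sets, and let (A_j)_{j∈J}, (Δ_l)_{l∈L}, (B_{jk})_{j∈J,k∈K}, (Γ_{kl})_{k∈K,l∈L} be bounded linear operators on H satisfying: ‖Σ_{j∈J} A_j A_j*‖ ≤ 1, ‖Σ_{l∈L} Δ_l* Δ_l‖ ≤ 1, the family (B_{jk}) has matrix norm ≤ M₁, and the family (Γ_{kl}) has matrix norm ≤ M₂. Then for all bounded operators T₁, T₂, T₃ on H, the operator W = Σ_{j∈J} Σ_{k∈K} Σ_{l∈L} A_j ∘ T₁ ∘ B_{jk} ∘ T₂ ∘ Γ_{kl} ∘ T₃ ∘ Δ_l satisfies ‖W‖ ≤ M₁ · M₂ · ‖T₁‖ · ‖T₂‖ · ‖T₃‖. (This is the boundedness estimate for quadruple operator integrals with integrand in the Haagerup tensor product of four L∞ spaces.) -/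
open scoped InnerProductSpace ContinuousLinearMap

/-- The column operator with entries `D i` is bounded by `‖∑ i, (D i)* (D i)‖ ^ (1 / 2)`. -/
lemma sum_norm_sq_apply_le_s9
    {H ι : Type*} [NormedAddCommGroup H] [InnerProductSpace ℂ H] [CompleteSpace H] [Fintype ι]
    (D : ι → (H →L[ℂ] H)) (x : H) :
    ∑ i, ‖D i x‖ ^ 2 ≤ ‖∑ i, (ContinuousLinearMap.adjoint (D i)) ∘L (D i)‖ * ‖x‖ ^ 2 := by
  set S := ∑ i, (ContinuousLinearMap.adjoint (D i)) ∘L (D i) with hS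
  have key : ∑ i, ‖D i x‖ ^ 2 = RCLike.re (inner ℂ (S x) x) := by
    simp only [hS, sum_apply, sum_inner, map_sum,
      ContinuousLinearMap.apply_norm_sq_eq_inner_adjoint_left]
  calc ∑ i, ‖D i x‖ ^ 2 = RCLike.re (inner ℂ (S x) x) := key
    _ ≤ ‖S x‖ * ‖x‖ := re_inner_le_norm _ _
    _ ≤ (‖S‖ * ‖x‖) * ‖x‖ := by gcongr; exact S.le_opNorm x
    _ = ‖S‖ * ‖x‖ ^ 2 := by ring

/-- The row operator with entries `A i` is bounded by `‖∑ i, (A i) (A i)*‖ ^ (1 / 2)`. -/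
lemma norm_sq_sum_apply_le
    {H ι : Type*} [NormedAddCommGroup H] [InnerProductSpace ℂ H] [CompleteSpace H] [Fintype ι]
    (A : ι → (H →L[ℂ] H)) (y : ι → H) :
    ‖∑ i, A i (y i)‖ ^ 2
      ≤ ‖∑ i, (A i) ∘L (ContinuousLinearMap.adjoint (A i))‖ * ∑ i, ‖y i‖ ^ 2 := by
  set C := ‖∑ i, (A i) ∘L (ContinuousLinearMap.adjoint (A i))‖ with hC
  set v := ∑ i, A i (y i) with hv
  have hcol : ∑ i, ‖ContinuousLinearMap.adjoint (A i) v‖ ^ 2 ≤ C * ‖v‖ ^ 2 := by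
    simpa only [ContinuousLinearMap.adjoint_adjoint] using
      sum_norm_sq_apply_le_s9 (fun i => ContinuousLinearMap.adjoint (A i)) v
  have hsq : ‖v‖ ^ 2 ≤ ∑ i, ‖ContinuousLinearMap.adjoint (A i) v‖ * ‖y i‖ := by
    calc ‖v‖ ^ 2 = RCLike.re (inner ℂ v v) := (inner_self_eq_norm_sq (𝕜 := ℂ) v).symm
      _ = RCLike.re (inner ℂ v (∑ i, A i (y i))) := by rw [← hv]
      _ = ∑ i, RCLike.re (inner ℂ (ContinuousLinearMap.adjoint (A i) v) (y i)) := by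
        simp only [inner_sum, map_sum, ContinuousLinearMap.adjoint_inner_left]
      _ ≤ _ := Finset.sum_le_sum fun i _ => re_inner_le_norm _ _
  have hfour : ‖v‖ ^ 2 * ‖v‖ ^ 2 ≤ (C * ∑ i, ‖y i‖ ^ 2) * ‖v‖ ^ 2 := by
    calc ‖v‖ ^ 2 * ‖v‖ ^ 2 = (‖v‖ ^ 2) ^ 2 := by ring
      _ ≤ (∑ i, ‖ContinuousLinearMap.adjoint (A i) v‖ * ‖y i‖) ^ 2 := by gcongr
      _ ≤ (∑ i, ‖ContinuousLinearMap.adjoint (A i) v‖ ^ 2) * ∑ i, ‖y i‖ ^ 2 :=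
        Finset.sum_mul_sq_le_sq_mul_sq _ _ _
      _ ≤ (C * ‖v‖ ^ 2) * ∑ i, ‖y i‖ ^ 2 := by gcongr
      _ = _ := by ring
  rcases (sq_nonneg ‖v‖).eq_or_lt with h | h
  · rw [← h]
    positivity
  · exact le_of_mul_le_mul_right hfour h

/-- The diagonal operator with constant entry `T` is bounded by `‖T‖`. -/
lemma sum_norm_sq_map_le
    {H ι : Type*} [NormedAddCommGroup H] [InnerProductSpace ℂ H] [Fintype ι]
    (T : H →L[ℂ] H) (x : ι → H) :
    ∑ i, ‖T (x i)‖ ^ 2 ≤ ‖T‖ ^ 2 * ∑ i, ‖x i‖ ^ 2 := by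
  rw [Finset.mul_sum]
  refine Finset.sum_le_sum fun i _ => ?_
  rw [← mul_pow]
  gcongr
  exact T.le_opNorm _

/-- Boundedness estimate for quadruple operator integrals with integrand in the
Haagerup tensor product of four `L∞` spaces: if `‖∑ j, A j (A j)*‖ ≤ 1`,
`‖∑ l, (Δ l)* (Δ l)‖ ≤ 1` and the families `(B j k)`, `(Γ k l)` have matrix norms at
most `M₁`, `M₂`, then for all bounded operators `T₁, T₂, T₃`,
`‖∑ j k l, A j ∘ T₁ ∘ B j k ∘ T₂ ∘ Γ k l ∘ T₃ ∘ Δ l‖ ≤ M₁ * M₂ * ‖T₁‖ * ‖T₂‖ * ‖T₃‖`. -/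
theorem quadruple_operator_integral_bounded
    {H : Type*} [NormedAddCommGroup H] [InnerProductSpace ℂ H] [CompleteSpace H]
    {J K L : Type*} [Fintype J] [Fintype K] [Fintype L]
    (A : J → (H →L[ℂ] H)) (Δ : L → (H →L[ℂ] H))
    (B : J → K → (H →L[ℂ] H)) (Γ : K → L → (H →L[ℂ] H))
    (M₁ M₂ : ℝ) (hM₁ : 0 ≤ M₁) (hM₂ : 0 ≤ M₂)
    (hA : ‖∑ j : J, (A j) ∘L (ContinuousLinearMap.adjoint (A j))‖ ≤ 1)
    (hΔ : ‖∑ l : L, (ContinuousLinearMap.adjoint (Δ l)) ∘L (Δ l)‖ ≤ 1)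
    (hB : ∀ x : K → H, ∑ j : J, ‖∑ k : K, (B j k) (x k)‖ ^ 2 ≤ M₁ ^ 2 * ∑ k : K, ‖x k‖ ^ 2)
    (hΓ : ∀ x : L → H, ∑ k : K, ‖∑ l : L, (Γ k l) (x l)‖ ^ 2 ≤ M₂ ^ 2 * ∑ l : L, ‖x l‖ ^ 2)
    (T₁ T₂ T₃ : H →L[ℂ] H) :
    ‖∑ j : J, ∑ k : K, ∑ l : L,
        (A j) ∘L T₁ ∘L (B j k) ∘L T₂ ∘L (Γ k l) ∘L T₃ ∘L (Δ l)‖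
      ≤ M₁ * M₂ * ‖T₁‖ * ‖T₂‖ * ‖T₃‖ := by
  refine ContinuousLinearMap.opNorm_le_bound _ (by positivity) fun x => ?_
  refine (sq_le_sq₀ (by positivity) (by positivity)).1 ?_
  set u : L → H := fun l => T₃ (Δ l x) with hu
  set w : K → H := fun k => T₂ (∑ l, Γ k l (u l)) with hw
  set y : J → H := fun j => T₁ (∑ k, B j k (w k)) with hy
  have hWx : (∑ j : J, ∑ k : K, ∑ l : L,
      (A j) ∘L T₁ ∘L (B j k) ∘L T₂ ∘L (Γ k l) ∘L T₃ ∘L (Δ l)) x = ∑ j, A j (y j) := by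
    simp only [hy, hw, hu, sum_apply, ContinuousLinearMap.comp_apply, map_sum]
  rw [hWx]
  calc ‖∑ j, A j (y j)‖ ^ 2
      ≤ ‖∑ j : J, (A j) ∘L (ContinuousLinearMap.adjoint (A j))‖ * ∑ j, ‖y j‖ ^ 2 :=
        norm_sq_sum_apply_le A y
    _ ≤ 1 * ∑ j, ‖y j‖ ^ 2 := by gcongr
    _ = ∑ j, ‖y j‖ ^ 2 := one_mul _
    _ ≤ ‖T₁‖ ^ 2 * ∑ j, ‖∑ k, B j k (w k)‖ ^ 2 := sum_norm_sq_map_le T₁ _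
    _ ≤ ‖T₁‖ ^ 2 * (M₁ ^ 2 * ∑ k, ‖w k‖ ^ 2) := by gcongr; exact hB w
    _ ≤ ‖T₁‖ ^ 2 * (M₁ ^ 2 * (‖T₂‖ ^ 2 * ∑ k, ‖∑ l, Γ k l (u l)‖ ^ 2)) := by
        gcongr; exact sum_norm_sq_map_le T₂ _
    _ ≤ ‖T₁‖ ^ 2 * (M₁ ^ 2 * (‖T₂‖ ^ 2 * (M₂ ^ 2 * ∑ l, ‖u l‖ ^ 2))) := by
        gcongr; exact hΓ u
    _ ≤ ‖T₁‖ ^ 2 * (M₁ ^ 2 * (‖T₂‖ ^ 2 * (M₂ ^ 2 * (‖T₃‖ ^ 2 * ∑ l, ‖Δ l x‖ ^ 2)))) := by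
        gcongr; exact sum_norm_sq_map_le T₃ _
    _ ≤ ‖T₁‖ ^ 2 * (M₁ ^ 2 * (‖T₂‖ ^ 2 * (M₂ ^ 2 * (‖T₃‖ ^ 2 * (1 * ‖x‖ ^ 2))))) := by
        gcongr
        exact (sum_norm_sq_apply_le_s9 Δ x).trans (by gcongr)
    _ = (M₁ * M₂ * ‖T₁‖ * ‖T₂‖ * ‖T₃‖ * ‖x‖) ^ 2 := by ring
end
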